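/- Let 0<ρ<1, T>0, α>0, let H be a complex Hilbert space, let g:[0,T]→H be continuous, and suppose M>0 is a constant such that |E_{ρ,2ρ−1}(−α s^ρ)| ≤ M and |E_{ρ,2ρ}(−α s^ρ)| ≤ M for all s≥0. Define F(t) = ∫₀ᵗ (t−τ)^{2ρ−1} E²_{ρ,2ρ}(−α(t−τ)^ρ) g(τ) dτ. Then for all t∈[0,T]: (i) ‖F(t)‖ ≤ (M T^{2ρ}(2+ρ)/(2ρ²)) · max_{0≤s≤T}‖g(s)‖; and (ii) ‖J^{−ρ}_t F(t)‖ ≤ (M/Γ(ρ)) · (T^{3ρ}/(2ρ³)) · (2+ρ) · max_{0≤s≤T}‖g(s)‖. -/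

import Mathlib

open MeasureTheory Set

/-- The two-parameter Mittag-Leffler function. -/
noncomputable def mlE (ρ : ℝ) (μ : ℂ) (z : ℂ) : ℂ :=
  ∑' k : ℕ, z ^ k / Complex.Gamma (((ρ * k : ℝ) : ℂ) + μ)

/-- The Prabhakar (three-parameter Mittag-Leffler) function with upper parameter `γ = 2`;
here `(2)_k / k! = k + 1`. -/
noncomputable def prab2 (ρ : ℝ) (μ : ℂ) (z : ℂ) : ℂ :=
  ∑' k : ℕ, ((k : ℂ) + 1) * z ^ k / Complex.Gamma (((ρ * k : ℝ) : ℂ) + μ)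

/-- Riemann–Liouville fractional integral of order ρ (Bochner integral). -/
noncomputable def rlInt {H : Type*} [NormedAddCommGroup H] [NormedSpace ℝ H]
    (ρ : ℝ) (h : ℝ → H) (t : ℝ) : H :=
  (1 / Real.Gamma ρ) • ∫ ξ in (0:ℝ)..t, ((t - ξ) ^ (ρ - 1) : ℝ) • h ξ

/-- The termwise contiguity relation
`ρ (k + 1) / Γ(ρk + 2ρ) = 1 / Γ(ρk + 2ρ - 1) + (1 - ρ) / Γ(ρk + 2ρ)`. -/
lemma prab2_term_eq (ρ : ℝ) (z : ℂ) (k : ℕ) :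
    (ρ : ℂ) * (((k : ℂ) + 1) * z ^ k / Complex.Gamma (((ρ * k : ℝ) : ℂ) + ((2 * ρ : ℝ) : ℂ))) =
      z ^ k / Complex.Gamma (((ρ * k : ℝ) : ℂ) + ((2 * ρ - 1 : ℝ) : ℂ)) +
      (1 - (ρ : ℂ)) * (z ^ k / Complex.Gamma (((ρ * k : ℝ) : ℂ) + ((2 * ρ : ℝ) : ℂ))) := by
  have h := Complex.one_div_Gamma_eq_self_mul_one_div_Gamma_add_one
    (((ρ * k : ℝ) : ℂ) + ((2 * ρ - 1 : ℝ) : ℂ))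
  have e : ((ρ * k : ℝ) : ℂ) + ((2 * ρ - 1 : ℝ) : ℂ) + 1 =
      ((ρ * k : ℝ) : ℂ) + ((2 * ρ : ℝ) : ℂ) := by push_cast; ring
  rw [e] at h
  simp only [div_eq_mul_inv] at h ⊢
  rw [h]
  push_cast
  ring

/-- If the Prabhakar series converges, it is a combination of two Mittag-Leffler functions. -/
lemma mul_prab2_eq (ρ : ℝ) (z : ℂ)
    (hs : Summable fun k : ℕ =>
      ((k : ℂ) + 1) * z ^ k / Complex.Gamma (((ρ * k : ℝ) : ℂ) + ((2 * ρ : ℝ) : ℂ))) :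
    (ρ : ℂ) * prab2 ρ ((2 * ρ : ℝ) : ℂ) z =
      mlE ρ ((2 * ρ - 1 : ℝ) : ℂ) z + (1 - (ρ : ℂ)) * mlE ρ ((2 * ρ : ℝ) : ℂ) z := by
  have ha : Summable fun k : ℕ =>
      z ^ k / Complex.Gamma (((ρ * k : ℝ) : ℂ) + ((2 * ρ : ℝ) : ℂ)) := by
    refine Summable.of_norm_bounded hs.norm fun k => ?_
    rw [mul_div_assoc, norm_mul]
    refine le_mul_of_one_le_left (norm_nonneg _) ?_
    have : ‖(k : ℂ) + 1‖ = k + 1 := by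
      exact_mod_cast Complex.norm_natCast (k + 1)
    rw [this]
    exact le_add_of_nonneg_left k.cast_nonneg
  have hb : Summable fun k : ℕ =>
      z ^ k / Complex.Gamma (((ρ * k : ℝ) : ℂ) + ((2 * ρ - 1 : ℝ) : ℂ)) := by
    refine ((hs.mul_left (ρ : ℂ)).sub (ha.mul_left (1 - (ρ : ℂ)))).congr fun k => ?_
    rw [prab2_term_eq]
    ring
  rw [prab2, mlE, mlE, ← tsum_mul_left, ← tsum_mul_left, ← hb.tsum_add (ha.mul_left _)]
  exact tsum_congr (prab2_term_eq ρ z)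

lemma norm_prab2_le {ρ M : ℝ} {z : ℂ} (hρ0 : 0 < ρ) (hρ1 : ρ < 1)
    (h1 : ‖mlE ρ ((2 * ρ - 1 : ℝ) : ℂ) z‖ ≤ M) (h2 : ‖mlE ρ ((2 * ρ : ℝ) : ℂ) z‖ ≤ M) :
    ‖prab2 ρ ((2 * ρ : ℝ) : ℂ) z‖ ≤ M * (2 - ρ) / ρ := by
  have hM : 0 ≤ M := (norm_nonneg _).trans h1
  by_cases hs : Summable fun k : ℕ =>
      ((k : ℂ) + 1) * z ^ k / Complex.Gamma (((ρ * k : ℝ) : ℂ) + ((2 * ρ : ℝ) : ℂ))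
  · have hρ : ‖(1 : ℂ) - ρ‖ = 1 - ρ := by
      rw [← Complex.ofReal_one, ← Complex.ofReal_sub, Complex.norm_of_nonneg (by linarith)]
    rw [le_div_iff₀ hρ0]
    calc ‖prab2 ρ ((2 * ρ : ℝ) : ℂ) z‖ * ρ = ‖(ρ : ℂ) * prab2 ρ ((2 * ρ : ℝ) : ℂ) z‖ := by
          rw [norm_mul, Complex.norm_of_nonneg hρ0.le, mul_comm]
      _ ≤ M + (1 - ρ) * M := by
          rw [mul_prab2_eq ρ z hs]
          refine (norm_add_le _ _).trans (add_le_add h1 ?_)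
          rw [norm_mul, hρ]
          exact mul_le_mul_of_nonneg_left h2 (by linarith)
      _ = M * (2 - ρ) := by ring
  · rw [prab2, tsum_eq_zero_of_not_summable hs, norm_zero]
    exact div_nonneg (mul_nonneg hM (by linarith)) hρ0.le

lemma norm_integral_le_of_norm_le_sub_rpow {E : Type*} [NormedAddCommGroup E] [NormedSpace ℝ E]
    {f : ℝ → E} {r t C : ℝ} (hr : 0 < r) (ht : 0 ≤ t)
    (hf : ∀ τ ∈ Ioc 0 t, ‖f τ‖ ≤ (t - τ) ^ (r - 1) * C) :
    ‖∫ τ in (0:ℝ)..t, f τ‖ ≤ t ^ r / r * C := by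
  have hi : IntervalIntegrable (fun τ : ℝ => (t - τ) ^ (r - 1)) volume 0 t := by
    have h := (intervalIntegral.intervalIntegrable_rpow' (a := t) (b := 0)
      (show -1 < r - 1 by linarith)).comp_sub_left t
    simpa using h
  refine (intervalIntegral.norm_integral_le_of_norm_le ht
    (Filter.Eventually.of_forall hf) (hi.mul_const C)).trans_eq ?_
  rw [intervalIntegral.integral_mul_const,
    intervalIntegral.integral_comp_sub_left (fun x : ℝ => x ^ (r - 1)) t, sub_self, sub_zero,
    integral_rpow (Or.inl (by linarith)), sub_add_cancel, Real.zero_rpow hr.ne', sub_zero]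

/-- Bounds for
`F(t) = ∫₀ᵗ (t-τ)^{2ρ-1} E²_{ρ,2ρ}(-α(t-τ)^ρ) g(τ) dτ` and its fractional integral. -/
theorem prabhakar_convolution_bounds
    {H : Type*} [NormedAddCommGroup H] [InnerProductSpace ℂ H] [CompleteSpace H]
    (ρ T α : ℝ) (hρ0 : 0 < ρ) (hρ1 : ρ < 1) (hT : 0 < T) (hα : 0 < α)
    (g : ℝ → H) (hg : ContinuousOn g (Icc 0 T))
    (M : ℝ) (hM : 0 < M)
    (hbound1 : ∀ s : ℝ, 0 ≤ s →
      ‖mlE ρ ((2 * ρ - 1 : ℝ) : ℂ) (-(α : ℂ) * ((s ^ ρ : ℝ) : ℂ))‖ ≤ M)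
    (hbound2 : ∀ s : ℝ, 0 ≤ s →
      ‖mlE ρ ((2 * ρ : ℝ) : ℂ) (-(α : ℂ) * ((s ^ ρ : ℝ) : ℂ))‖ ≤ M)
    (F : ℝ → H)
    (hF : ∀ t : ℝ, F t = ∫ τ in (0:ℝ)..t,
      ((((t - τ) ^ (2 * ρ - 1) : ℝ) : ℂ) *
        prab2 ρ ((2 * ρ : ℝ) : ℂ) (-(α : ℂ) * (((t - τ) ^ ρ : ℝ) : ℂ))) • g τ) :
    ∀ t ∈ Icc (0:ℝ) T,
      ‖F t‖ ≤ (M * T ^ (2 * ρ) * (2 + ρ) / (2 * ρ ^ 2)) * ⨆ s : Icc (0:ℝ) T, ‖g s‖ ∧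
      ‖rlInt ρ F t‖ ≤
        (M / Real.Gamma ρ) * (T ^ (3 * ρ) / (2 * ρ ^ 3)) * (2 + ρ) *
          ⨆ s : Icc (0:ℝ) T, ‖g s‖ := by
  set S := ⨆ s : Icc (0:ℝ) T, ‖g s‖
  have hgS : ∀ s ∈ Icc (0:ℝ) T, ‖g s‖ ≤ S := fun s hs => by
    have hb : BddAbove (range fun s : Icc (0:ℝ) T => ‖g s‖) := by
      have := isCompact_Icc.bddAbove_image hg.norm
      rwa [image_eq_range] at this
    exact le_ciSup hb ⟨s, hs⟩
  have hS0 : 0 ≤ S := (norm_nonneg _).trans (hgS 0 ⟨le_rfl, hT.le⟩)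
  have hFb : ∀ t ∈ Icc (0:ℝ) T,
      ‖F t‖ ≤ (M * T ^ (2 * ρ) * (2 + ρ) / (2 * ρ ^ 2)) * S := by
    intro t ht
    rw [hF t]
    refine (norm_integral_le_of_norm_le_sub_rpow (r := 2 * ρ) (C := M * (2 + ρ) / ρ * S)
      (by linarith) ht.1 fun τ hτ => ?_).trans ?_
    · have hτt : 0 ≤ t - τ := sub_nonneg.2 hτ.2
      rw [norm_smul, norm_mul, Complex.norm_of_nonneg (Real.rpow_nonneg hτt _), mul_assoc]
      have hp := norm_prab2_le hρ0 hρ1 (hbound1 _ hτt) (hbound2 _ hτt)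
      have hp' : M * (2 - ρ) / ρ ≤ M * (2 + ρ) / ρ := by gcongr; linarith
      exact mul_le_mul_of_nonneg_left
        (mul_le_mul (hp.trans hp') (hgS τ ⟨hτ.1.le, hτ.2.trans ht.2⟩) (norm_nonneg _)
          (by positivity)) (Real.rpow_nonneg hτt _)
    · calc t ^ (2 * ρ) / (2 * ρ) * (M * (2 + ρ) / ρ * S)
          ≤ T ^ (2 * ρ) / (2 * ρ) * (M * (2 + ρ) / ρ * S) := by
            gcongr
            exacts [ht.1, ht.2]
        _ = (M * T ^ (2 * ρ) * (2 + ρ) / (2 * ρ ^ 2)) * S := by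
            field_simp
  refine fun t ht => ⟨hFb t ht, ?_⟩
  have hΓ : 0 < Real.Gamma ρ := Real.Gamma_pos_of_pos hρ0
  have hI := norm_integral_le_of_norm_le_sub_rpow (r := ρ)
    (f := fun ξ => ((t - ξ) ^ (ρ - 1) : ℝ) • F ξ) hρ0 ht.1 fun ξ hξ => by
      have hξt : 0 ≤ t - ξ := sub_nonneg.2 hξ.2
      rw [norm_smul, Real.norm_of_nonneg (Real.rpow_nonneg hξt _)]
      exact mul_le_mul_of_nonneg_left (hFb ξ ⟨hξ.1.le, hξ.2.trans ht.2⟩) (Real.rpow_nonneg hξt _)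
  rw [rlInt, norm_smul, Real.norm_of_nonneg (by positivity)]
  calc 1 / Real.Gamma ρ * ‖∫ ξ in (0:ℝ)..t, ((t - ξ) ^ (ρ - 1) : ℝ) • F ξ‖
      ≤ 1 / Real.Gamma ρ *
          (T ^ ρ / ρ * ((M * T ^ (2 * ρ) * (2 + ρ) / (2 * ρ ^ 2)) * S)) := by
        refine mul_le_mul_of_nonneg_left (hI.trans ?_) (by positivity)
        gcongr
        exacts [ht.1, ht.2]
    _ = (M / Real.Gamma ρ) * (T ^ (3 * ρ) / (2 * ρ ^ 3)) * (2 + ρ) * S := by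
        rw [show 3 * ρ = ρ + 2 * ρ by ring, Real.rpow_add hT]
        field_simp
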